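/- arXiv:1401.4907 — 3 statements merged into one kernel-verified Lean document; each statement's English description precedes it below -/
import Mathlib

section
/- Let Θ = (α, ρ_r, ρ_d, ρ_s, ρ_0, T) be a parameter tuple satisfying min(T/4, 1/(3·ρ_0/ρ_r), 3·(ρ_d/ρ_r)/(2·ρ_0/ρ_r)) > 10, and let R > 0. Set K' := max( min( R/x'(R,Θ), K_max(Θ) ), 1 ) and M' := K' + sqrt(K')·sqrt( α·(2^(R/K') − 1)/ρ_r ). Then (M',K') is the unique minimizer of P_csi(M,K,R,Θ) over all real pairs (M,K) with 1 ≤ K ≤ K_max(Θ) and M > K. -/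
open Real

/-- Uplink SINR-like quantity γ_u(M,K,τ,R,T). -/
noncomputable def gammaU (M K τ R T : ℝ) : ℝ :=
  ((K + τ) * ((2:ℝ) ^ (R / (K * (1 - τ / T))) - 1)) / (2 * τ * (M - K)) +
    Real.sqrt ((((K + τ) * ((2:ℝ) ^ (R / (K * (1 - τ / T))) - 1)) / (2 * τ * (M - K))) ^ 2 +
      ((2:ℝ) ^ (R / (K * (1 - τ / T))) - 1) / (τ * (M - K)))

/-- Total normalized power consumption P(M,K,τ,R,Θ). -/
noncomputable def Ptot (M K τ R α ρr ρd ρs ρ0 T : ℝ) : ℝ :=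
  α * K * gammaU M K τ R T + ρs + K * (ρd + (8/3) * K ^ 2 * ρ0 / T) +
    M * (ρr + 2 * K * ρ0 + 4 * K ^ 2 * ρ0 / T)

/-- Optimal normalized energy efficiency ζ*_zf(R,Θ) (integer optimization). -/
noncomputable def zetaZfStar (R α ρr ρd ρs ρ0 T : ℝ) : ℝ :=
  R / sInf {p : ℝ | ∃ M K τ : ℤ, 1 ≤ K ∧ K ≤ τ ∧ (τ : ℝ) < T ∧ K < M ∧
    p = Ptot (M : ℝ) (K : ℝ) (τ : ℝ) R α ρr ρd ρs ρ0 T}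

/-- Maximum number of users K_max(Θ). -/
noncomputable def Kmax (ρr ρd ρ0 T : ℝ) : ℝ :=
  min (T / 4) (min (ρr / (3 * ρ0)) (3 * ρd / (2 * ρ0)))

/-- The function g(x). -/
noncomputable def gfun (x : ℝ) : ℝ :=
  Real.sqrt (x / ((2:ℝ) ^ x - 1)) * ((2:ℝ) ^ x * x * Real.log 2 - (2:ℝ) ^ x + 1)

/-- Ideal (perfect CSI) power consumption P_csi(M,K,R,Θ). -/
noncomputable def Pcsi (M K R α ρr ρd ρs : ℝ) : ℝ :=
  α * K * ((2:ℝ) ^ (R / K) - 1) / (M - K) + M * ρr + K * ρd + ρs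

/-- Relaxed (real-valued) optimal EE ζ'_zf(R,Θ) with K ≤ K_max(Θ). -/
noncomputable def zetaZfPrime (R α ρr ρd ρs ρ0 T : ℝ) : ℝ :=
  R / sInf {p : ℝ | ∃ M K τ : ℝ, 1 ≤ K ∧ K ≤ Kmax ρr ρd ρ0 T ∧ K ≤ τ ∧ τ < T ∧ K < M ∧
    p = Ptot M K τ R α ρr ρd ρs ρ0 T}

/-- Optimal EE of the ideal perfect-CSI system ζ'_csi(R,Θ). -/
noncomputable def zetaCsiPrime (R α ρr ρd ρs ρ0 T : ℝ) : ℝ :=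
  R / sInf {p : ℝ | ∃ M K : ℝ, 1 ≤ K ∧ K ≤ Kmax ρr ρd ρ0 T ∧ K < M ∧
    p = Pcsi M K R α ρr ρd ρs}

/-- Relaxed optimal EE with the number of users fixed to K. -/
noncomputable def zetaZfFixedK (K R α ρr ρd ρs ρ0 T : ℝ) : ℝ :=
  R / sInf {p : ℝ | ∃ M τ : ℝ, K < M ∧ K ≤ τ ∧ τ < T ∧
    p = Ptot M K τ R α ρr ρd ρs ρ0 T}

/-- The power `Pcsi` minimized over `M`, as a function of the number of users `K`. -/
noncomputable def reducedPower (R α ρr ρd ρs K : ℝ) : ℝ :=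
  2 * ρr * √(K * (α * ((2:ℝ) ^ (R / K) - 1) / ρr)) + K * (ρr + ρd) + ρs

lemma two_rpow_sub_one_pos {x : ℝ} (hx : 0 < x) : 0 < (2:ℝ) ^ x - 1 :=
  sub_pos.2 (one_lt_rpow one_lt_two hx)

lemma strictAntiOn_one_sub_exp_neg_div :
    StrictAntiOn (fun t : ℝ => (1 - exp (-t)) / t) (Set.Ioi 0) := by
  intro a ha b hb hab
  have ha' : 0 < a := ha
  have hb' : 0 < b := hb
  have h := strictConvexOn_exp.secant_strict_mono (a := 0) (x := -b) (y := -a)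
    trivial trivial trivial (by linarith) (by linarith) (by linarith)
  simp only [exp_zero, sub_zero] at h
  have e (t : ℝ) : (1 - exp (-t)) / t = (exp (-t) - 1) / -t := by
    rw [div_neg, ← neg_div, neg_sub]
  simpa only [e] using h

lemma gfun_eq {x : ℝ} (hx : 0 < x) :
    gfun x = √(x * ((2:ℝ) ^ x - 1)) * (((1 - exp (-(x * log 2))) / (x * log 2))⁻¹ - 1) := by
  have hp := two_rpow_sub_one_pos hx
  have he : exp (-(x * log 2)) = ((2:ℝ) ^ x)⁻¹ := by
    rw [exp_neg, rpow_def_of_pos two_pos, mul_comm]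
  have hsqrt : √(x * ((2:ℝ) ^ x - 1)) = √(x / ((2:ℝ) ^ x - 1)) * ((2:ℝ) ^ x - 1) := by
    rw [← sqrt_sq hp.le, ← sqrt_mul (by positivity), sqrt_sq hp.le]
    congr 1
    field_simp
  have h2 : (2:ℝ) ^ x ≠ 0 := by positivity
  rw [gfun, he, hsqrt, mul_assoc (√_)]
  congr 1
  have h3 : 1 - ((2:ℝ) ^ x)⁻¹ = ((2:ℝ) ^ x - 1) / (2:ℝ) ^ x := by field_simp
  rw [h3]
  have := hp.ne'
  have hl : log 2 ≠ 0 := (log_pos one_lt_two).ne'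
  field_simp
  ring

lemma strictMonoOn_gfun : StrictMonoOn gfun (Set.Ioi 0) := by
  intro x hx y hy hxy
  have hx0 : 0 < x := hx
  have hy0 : 0 < y := hy
  have hl : 0 < log 2 := log_pos one_lt_two
  have hpx := two_rpow_sub_one_pos hx0
  have hpy := two_rpow_sub_one_pos hy0
  have hpow : (2:ℝ) ^ x < (2:ℝ) ^ y := rpow_lt_rpow_of_exponent_lt one_lt_two hxy
  have hpos {t : ℝ} (ht : 0 < t) : 0 < (1 - exp (-t)) / t :=
    div_pos (sub_pos.2 (exp_lt_one_iff.2 (neg_lt_zero.2 ht))) ht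
  have hle {t : ℝ} (ht : 0 < t) : (1 - exp (-t)) / t ≤ 1 := by
    rw [div_le_one ht]
    linarith [add_one_le_exp (-t)]
  rw [gfun_eq hx0, gfun_eq hy0]
  refine mul_lt_mul'' (sqrt_lt_sqrt (by positivity) ?_) (sub_lt_sub_right ?_ 1) (sqrt_nonneg _) ?_
  · exact mul_lt_mul'' hxy (by linarith) hx0.le hpx.le
  · refine inv_strictAnti₀ (hpos (by positivity)) ?_
    exact strictAntiOn_one_sub_exp_neg_div (mul_pos hx0 hl) (mul_pos hy0 hl)
      (mul_lt_mul_of_pos_right hxy hl)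
  · exact sub_nonneg.2 ((one_le_inv₀ (hpos (by positivity))).2 (hle (by positivity)))

lemma hasDerivAt_reducedPower {R α ρr K : ℝ} (ρd ρs : ℝ) (hR : 0 < R) (hα : 0 < α)
    (hρr : 0 < ρr) (hK : 0 < K) :
    HasDerivAt (reducedPower R α ρr ρd ρs)
      (ρr + ρd - √(α * ρr / R) * gfun (R / K)) K := by
  have hp := two_rpow_sub_one_pos (div_pos hR hK)
  have hf : 0 < K * (α * ((2:ℝ) ^ (R / K) - 1) / ρr) := by positivity
  have h1 : HasDerivAt (fun K : ℝ => R / K) (-R / K ^ 2) K := by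
    simpa using (hasDerivAt_const K R).fun_div (hasDerivAt_id' K) hK.ne'
  have h2 := h1.const_rpow (a := 2) two_pos
  have h3 := (hasDerivAt_id' K).fun_mul (((h2.sub_const 1).const_mul α).div_const ρr)
  have h4 := (((h3.sqrt hf.ne').const_mul (2 * ρr)).fun_add
    ((hasDerivAt_id' K).mul_const (ρr + ρd))).add_const ρs
  refine h4.congr_deriv ?_
  have key : √(α * ρr / R) * √(R / K / ((2:ℝ) ^ (R / K) - 1)) =
      α / √(K * (α * ((2:ℝ) ^ (R / K) - 1) / ρr)) := by
    rw [← sqrt_mul (by positivity), eq_div_iff (sqrt_pos.2 hf).ne', ← sqrt_mul (by positivity)]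
    rw [sqrt_eq_iff_mul_self_eq (by positivity) hα.le]
    field_simp
  rw [gfun, ← mul_assoc (√_) (√_), key]
  have hs := (sqrt_pos.2 hf).ne'
  generalize √(K * (α * ((2:ℝ) ^ (R / K) - 1) / ρr)) = s at hs
  generalize (2:ℝ) ^ (R / K) = e
  field_simp
  ring

lemma Pcsi_eq_reducedPower_add {M K R α ρr : ℝ} (ρd ρs : ℝ) (hR : 0 < R) (hα : 0 < α)
    (hρr : 0 < ρr) (hK : 0 < K) (hM : K < M) :
    Pcsi M K R α ρr ρd ρs = reducedPower R α ρr ρd ρs K +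
      ρr * (√(K * (α * ((2:ℝ) ^ (R / K) - 1) / ρr)) - (M - K)) ^ 2 / (M - K) := by
  have hp := two_rpow_sub_one_pos (div_pos hR hK)
  have hN : M - K ≠ 0 := (sub_pos.2 hM).ne'
  have hs := sq_sqrt (show 0 ≤ K * (α * ((2:ℝ) ^ (R / K) - 1) / ρr) by positivity)
  have hs' : ρr * √(K * (α * ((2:ℝ) ^ (R / K) - 1) / ρr)) ^ 2 =
      α * K * ((2:ℝ) ^ (R / K) - 1) := by
    rw [hs]; field_simp
  rw [Pcsi, reducedPower, ← hs']
  generalize √(K * (α * ((2:ℝ) ^ (R / K) - 1) / ρr)) = s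
  field_simp
  ring

lemma sqrt_mul_gfun_eq {α ρr ρd R x' : ℝ} (hR : 0 < R) (hα : 0 < α) (hρr : 0 < ρr)
    (hgx' : gfun x' = (1 + ρd / ρr) * √(R * ρr / α)) :
    √(α * ρr / R) * gfun x' = ρr + ρd := by
  have h : √(α * ρr / R) * √(R * ρr / α) = ρr := by
    rw [← sqrt_mul (by positivity), sqrt_eq_iff_mul_self_eq (by positivity) hρr.le]
    field_simp
  rw [hgx', mul_left_comm, h]
  field_simp

lemma strictAntiOn_reducedPower {α ρr ρd R x' : ℝ} (ρs : ℝ) (hR : 0 < R) (hα : 0 < α)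
    (hρr : 0 < ρr) (hx' : 0 < x') (hgx' : gfun x' = (1 + ρd / ρr) * √(R * ρr / α)) :
    StrictAntiOn (reducedPower R α ρr ρd ρs) (Set.Ioc 0 (R / x')) := by
  refine strictAntiOn_of_deriv_neg (convex_Ioc _ _) (fun K hK =>
    (hasDerivAt_reducedPower ρd ρs hR hα hρr hK.1).continuousAt.continuousWithinAt) ?_
  intro K hK
  rw [interior_Ioc] at hK
  rw [(hasDerivAt_reducedPower ρd ρs hR hα hρr hK.1).deriv, sub_neg,
    ← sqrt_mul_gfun_eq hR hα hρr hgx']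
  refine mul_lt_mul_of_pos_left (strictMonoOn_gfun hx' (div_pos hR hK.1) ?_) (by positivity)
  exact (lt_div_comm₀ hK.1 hx').1 hK.2

lemma strictMonoOn_reducedPower {α ρr ρd R x' : ℝ} (ρs : ℝ) (hR : 0 < R) (hα : 0 < α)
    (hρr : 0 < ρr) (hx' : 0 < x') (hgx' : gfun x' = (1 + ρd / ρr) * √(R * ρr / α)) :
    StrictMonoOn (reducedPower R α ρr ρd ρs) (Set.Ici (R / x')) := by
  have h0 : 0 < R / x' := div_pos hR hx'
  refine strictMonoOn_of_deriv_pos (convex_Ici _) (fun K hK =>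
    (hasDerivAt_reducedPower ρd ρs hR hα hρr
      (h0.trans_le hK)).continuousAt.continuousWithinAt) ?_
  intro K hK
  rw [interior_Ici] at hK
  have hK0 : 0 < K := h0.trans hK
  rw [(hasDerivAt_reducedPower ρd ρs hR hα hρr hK0).deriv, sub_pos,
    ← sqrt_mul_gfun_eq hR hα hρr hgx']
  refine mul_lt_mul_of_pos_left (strictMonoOn_gfun (div_pos hR hK0) hx' ?_) (by positivity)
  exact (div_lt_comm₀ hx' hK0).1 hK

/-- (M',K') is the unique minimizer of P_csi over the feasible region
(Theorem 8). -/
theorem stmt_8 (α ρr ρd ρs ρ0 T R x' K' M' : ℝ)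
    (hα : 1 < α) (hρr : 0 < ρr) (hρd : 0 < ρd) (hρs : 0 < ρs) (hρ0 : 0 < ρ0) (hT : 1 < T)
    (hcond : 10 < min (T / 4) (min (1 / (3 * (ρ0 / ρr))) (3 * (ρd / ρr) / (2 * (ρ0 / ρr)))))
    (hR : 0 < R)
    (hx' : 0 < x') (hgx' : gfun x' = (1 + ρd / ρr) * Real.sqrt (R * ρr / α))
    (hK' : K' = max (min (R / x') (Kmax ρr ρd ρ0 T)) 1)
    (hM' : M' = K' + Real.sqrt K' * Real.sqrt (α * ((2:ℝ) ^ (R / K') - 1) / ρr)) :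
    (1 ≤ K' ∧ K' ≤ Kmax ρr ρd ρ0 T ∧ K' < M') ∧
      ∀ M K : ℝ, 1 ≤ K → K ≤ Kmax ρr ρd ρ0 T → K < M →
        Pcsi M' K' R α ρr ρd ρs ≤ Pcsi M K R α ρr ρd ρs ∧
          (Pcsi M K R α ρr ρd ρs = Pcsi M' K' R α ρr ρd ρs → M = M' ∧ K = K') := by
  have hα0 : 0 < α := one_pos.trans hα
  have hKm : 1 ≤ Kmax ρr ρd ρ0 T := by
    have e1 : 1 / (3 * (ρ0 / ρr)) = ρr / (3 * ρ0) := by field_simp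
    have e2 : 3 * (ρd / ρr) / (2 * (ρ0 / ρr)) = 3 * ρd / (2 * ρ0) := by field_simp
    rw [e1, e2] at hcond
    rw [Kmax]
    linarith
  have hK1 : 1 ≤ K' := hK' ▸ le_max_right _ _
  have hK0 : 0 < K' := one_pos.trans_le hK1
  have hp := two_rpow_sub_one_pos (div_pos hR hK0)
  rw [← sqrt_mul hK0.le] at hM'
  have hKM : K' < M' := by
    rw [hM', lt_add_iff_pos_right]
    positivity
  have hmin : Pcsi M' K' R α ρr ρd ρs = reducedPower R α ρr ρd ρs K' := by
    rw [Pcsi_eq_reducedPower_add ρd ρs hR hα0 hρr hK0 hKM, hM']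
    simp
  refine ⟨⟨hK1, hK' ▸ max_le (min_le_right _ _) hKm, hKM⟩, fun M K h1 h2 h3 => ?_⟩
  have hK : 0 < K := one_pos.trans_le h1
  have hN : 0 < M - K := sub_pos.2 h3
  have hPcsi := Pcsi_eq_reducedPower_add ρd ρs hR hα0 hρr hK h3
  rcases eq_or_ne K K' with rfl | hne
  · rw [hmin, hPcsi]
    refine ⟨le_add_of_nonneg_right (by positivity), fun h => ⟨?_, rfl⟩⟩
    rw [add_eq_left, div_eq_zero_iff, or_iff_left hN.ne', mul_eq_zero, or_iff_right hρr.ne',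
      sq_eq_zero_iff, sub_eq_zero] at h
    rw [hM', h]
    ring
  · have hlt : reducedPower R α ρr ρd ρs K' < reducedPower R α ρr ρd ρs K := by
      rcases lt_or_gt_of_ne hne with h | h
      · have hle : K' ≤ R / x' := by
          rcases le_max_iff.1 hK'.le with h' | h'
          · exact h'.trans (min_le_left _ _)
          · linarith
        exact strictAntiOn_reducedPower ρs hR hα0 hρr hx' hgx' ⟨hK, h.le.trans hle⟩
          ⟨hK0, hle⟩ h
      · have hle : R / x' ≤ K' := by
          rcases min_le_iff.1 (max_le_iff.1 hK'.ge).1 with h' | h'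
          · exact h'
          · linarith
        exact strictMonoOn_reducedPower ρs hR hα0 hρr hx' hgx' hle (hle.trans h.le) h
    have hlt' : Pcsi M' K' R α ρr ρd ρs < Pcsi M K R α ρr ρd ρs := by
      rw [hmin, hPcsi]
      exact lt_add_of_lt_of_nonneg hlt (by positivity)
    exact ⟨hlt'.le, fun h => absurd h hlt'.ne'⟩
end

section
/- Let Θ = (α, ρ_r, ρ_d, ρ_s, ρ_0, T) be a parameter tuple with δ := ρ_s/ρ_r satisfying min(T/4, 1/(3·ρ_0/ρ_r), 3·(ρ_d/ρ_r)/(2·ρ_0/ρ_r)) > 10 and ρ_r > α/(2δ). Then for every R > 0, (3/8)·ζ'_csi(4R/3, Θ) < ζ'_zf(R,Θ) < ζ'_csi(R,Θ). -/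
open Real

theorem le_Pcsi {M K R α ρr ρd ρs : ℝ} (hα : 0 < α) (hρr : 0 < ρr) (hρd : 0 < ρd)
    (hK : 1 ≤ K) (hKM : K < M) (hR : 0 < R) : ρs ≤ Pcsi M K R α ρr ρd ρs := by
  have hK0 : 0 < K := by linarith
  have hE : (1:ℝ) ≤ 2 ^ (R / K) := Real.one_le_rpow (by norm_num) (by positivity)
  have h1 : 0 ≤ α * K * ((2:ℝ) ^ (R / K) - 1) / (M - K) :=
    div_nonneg (mul_nonneg (by positivity) (by linarith)) (by linarith)
  have h2 : 0 ≤ M * ρr := mul_nonneg (by linarith) hρr.le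
  have h3 : 0 ≤ K * ρd := by positivity
  unfold Pcsi
  linarith

/-- Channel estimation costs power: the pilot overhead raises the required transmit power, and
the processing terms add at least `2 * ρ0`. -/
theorem Pcsi_add_le_Ptot {M K τ R α ρr ρd ρs ρ0 T : ℝ} (hα : 0 < α) (hρ0 : 0 < ρ0)
    (hT : 0 < T) (hK : 1 ≤ K) (hKτ : K ≤ τ) (hτT : τ < T) (hKM : K < M) (hR : 0 < R) :
    Pcsi M K R α ρr ρd ρs + 2 * ρ0 ≤ Ptot M K τ R α ρr ρd ρs ρ0 T := by
  have hK0 : 0 < K := by linarith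
  have hτ0 : 0 < τ := by linarith
  have hM0 : 0 < M := by linarith
  have hMK : 0 < M - K := by linarith
  have hτ1 : 0 < 1 - τ / T := sub_pos.2 ((div_lt_one hT).2 hτT)
  have hτ2 : 1 - τ / T ≤ 1 := sub_le_self _ (by positivity)
  have hF1 : (1:ℝ) ≤ 2 ^ (R / K) := Real.one_le_rpow (by norm_num) (by positivity)
  have hFE : (2:ℝ) ^ (R / K) ≤ 2 ^ (R / (K * (1 - τ / T))) := by
    apply Real.rpow_le_rpow_of_exponent_le (by norm_num)
    apply div_le_div_of_nonneg_left hR.le (by positivity)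
    nlinarith
  have hγ : ((2:ℝ) ^ (R / K) - 1) / (M - K) ≤ gammaU M K τ R T := by
    unfold gammaU
    set E := (2:ℝ) ^ (R / (K * (1 - τ / T))) - 1 with hEdef
    have hE0 : 0 ≤ E := by linarith
    set a := (K + τ) * E / (2 * τ * (M - K)) with ha
    have ha0 : 0 ≤ a := by positivity
    have hb0 : 0 ≤ E / (τ * (M - K)) := by positivity
    have hs : a ≤ √(a ^ 2 + E / (τ * (M - K))) := Real.le_sqrt_of_sq_le (by linarith)
    have h2a : 2 * a = E / (M - K) + K * E / (τ * (M - K)) := by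
      rw [ha]; field_simp; ring
    have h3 : 0 ≤ K * E / (τ * (M - K)) := by positivity
    have h4 : ((2:ℝ) ^ (R / K) - 1) / (M - K) ≤ E / (M - K) := by
      gcongr; linarith
    linarith
  have h1 : α * K * ((2:ℝ) ^ (R / K) - 1) / (M - K) ≤ α * K * gammaU M K τ R T := by
    rw [mul_div_assoc]; gcongr
  have h2 : 0 ≤ K * ((8/3) * K ^ 2 * ρ0 / T) := by positivity
  have h3 : 0 ≤ M * (4 * K ^ 2 * ρ0 / T) := by positivity
  have hMK1 : 1 ≤ M * K := by nlinarith
  have h4 : 2 * ρ0 ≤ M * (2 * K * ρ0) := by nlinarith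
  unfold Pcsi Ptot
  linarith

/-- Spending a quarter of the coherence interval on pilots at most doubles the power of the ideal
system operated at the rate `4 * R / 3`, up to a constant. -/
theorem Ptot_quarter_le {M K R α ρr ρd ρs ρ0 T : ℝ} (hα : 0 < α) (hρ0 : 0 < ρ0)
    (hT : 0 < T) (hK : 1 ≤ K) (hKmax : K ≤ Kmax ρr ρd ρ0 T) (hKM : K < M) (hR : 0 < R) :
    Ptot M K (T / 4) R α ρr ρd ρs ρ0 T ≤
      2 * Pcsi M K (4 * R / 3) α ρr ρd ρs - ρs + α / 2 := by
  have hK0 : 0 < K := by linarith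
  have hM0 : 0 < M := by linarith
  have hMK : 0 < M - K := by linarith
  obtain ⟨hKT, hKr, hKd⟩ : K ≤ T / 4 ∧ K ≤ ρr / (3 * ρ0) ∧ K ≤ 3 * ρd / (2 * ρ0) := by
    simpa [Kmax] using hKmax
  rw [le_div_iff₀ (by positivity)] at hKr hKd
  have hexp : R / (K * (1 - T / 4 / T)) = 4 * R / 3 / K := by
    have : 1 - T / 4 / T = 3 / 4 := by field_simp; norm_num
    rw [this]; field_simp
  have hγ : gammaU M K (T / 4) R T ≤
      2 * (((2:ℝ) ^ (4 * R / 3 / K) - 1) / (M - K)) + 1 / (2 * (T / 4)) := by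
    unfold gammaU
    rw [hexp]
    have hF1 : (1:ℝ) ≤ 2 ^ (4 * R / 3 / K) := Real.one_le_rpow (by norm_num) (by positivity)
    set E := (2:ℝ) ^ (4 * R / 3 / K) - 1 with hEdef
    have hE0 : 0 ≤ E := by linarith
    set τ := T / 4 with hτ
    have hτ0 : 0 < τ := by positivity
    set a := (K + τ) * E / (2 * τ * (M - K)) with ha
    have ha0 : 0 ≤ a := by positivity
    have hb : E / (τ * (M - K)) = E / (M - K) / τ := by field_simp
    have hae : a ≤ E / (M - K) := by
      rw [ha, div_le_div_iff₀ (by positivity) hMK]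
      nlinarith [mul_nonneg (mul_nonneg hE0 hMK.le) (sub_nonneg.2 hKT)]
    rw [hb]
    set e := E / (M - K) with he
    have hs : √(a ^ 2 + e / τ) ≤ e + 1 / (2 * τ) := by
      apply Real.sqrt_le_iff.2 ⟨by positivity, ?_⟩
      have : (e + 1 / (2 * τ)) ^ 2 = e ^ 2 + e / τ + (1 / (2 * τ)) ^ 2 := by
        field_simp; ring
      rw [this]
      nlinarith [sq_nonneg (1 / (2 * τ))]
    linarith
  have h1 : α * K * gammaU M K (T / 4) R T ≤
      2 * (α * K * ((2:ℝ) ^ (4 * R / 3 / K) - 1) / (M - K)) + α / 2 := by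
    have h5 := mul_le_mul_of_nonneg_left hγ (mul_pos hα hK0).le
    have h6 : α * K * (1 / (2 * (T / 4))) ≤ α / 2 := by
      rw [mul_one_div, div_le_div_iff₀ (by positivity) (by norm_num)]
      nlinarith
    rw [mul_add] at h5
    have h7 : α * K * (2 * (((2:ℝ) ^ (4 * R / 3 / K) - 1) / (M - K))) =
      2 * (α * K * ((2:ℝ) ^ (4 * R / 3 / K) - 1) / (M - K)) := by ring
    linarith
  have hq : K ^ 2 * ρ0 / T ≤ K * ρ0 / 4 := by
    rw [div_le_div_iff₀ hT (by norm_num)]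
    nlinarith [mul_pos hK0 hρ0]
  have h2 : K * (ρd + (8/3) * K ^ 2 * ρ0 / T) ≤ K * (2 * ρd) := by
    have : (8/3) * K ^ 2 * ρ0 / T = (8/3) * (K ^ 2 * ρ0 / T) := by ring
    gcongr
    linarith
  have h3 : M * (ρr + 2 * K * ρ0 + 4 * K ^ 2 * ρ0 / T) ≤ M * (2 * ρr) := by
    have : 4 * K ^ 2 * ρ0 / T = 4 * (K ^ 2 * ρ0 / T) := by ring
    gcongr
    linarith
  unfold Ptot Pcsi
  linarith

/-- for every R > 0, (3/8)·ζ'_csi(4R/3,Θ) < ζ'_zf(R,Θ) < ζ'_csi(R,Θ)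
(Corollary 1). -/
theorem stmt_15 (α ρr ρd ρs ρ0 T : ℝ)
    (hα : 1 < α) (hρr : 0 < ρr) (hρd : 0 < ρd) (hρs : 0 < ρs) (hρ0 : 0 < ρ0) (hT : 1 < T)
    (hcond : 10 < min (T / 4)
      (min (1 / (3 * (ρ0 / ρr))) (3 * (ρd / ρr) / (2 * (ρ0 / ρr)))))
    (hD1 : ρr > α / (2 * (ρs / ρr))) :
    ∀ R : ℝ, 0 < R →
      (3/8) * zetaCsiPrime (4 * R / 3) α ρr ρd ρs ρ0 T < zetaZfPrime R α ρr ρd ρs ρ0 T ∧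
        zetaZfPrime R α ρr ρd ρs ρ0 T < zetaCsiPrime R α ρr ρd ρs ρ0 T := by
  intro R hR
  have hα0 : 0 < α := by linarith
  have hT0 : 0 < T := by linarith
  have hKm : 1 ≤ Kmax ρr ρd ρ0 T := by
    have e1 : 1 / (3 * (ρ0 / ρr)) = ρr / (3 * ρ0) := by field_simp
    have e2 : 3 * (ρd / ρr) / (2 * (ρ0 / ρr)) = 3 * ρd / (2 * ρ0) := by field_simp
    rw [e1, e2] at hcond
    unfold Kmax
    linarith
  have hαs : α / 2 < ρs := by
    have e : α / (2 * (ρs / ρr)) = α / 2 / ρs * ρr := by field_simp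
    rw [e] at hD1
    have : α / 2 / ρs < 1 := by nlinarith
    exact (div_lt_one hρs).1 this
  unfold zetaCsiPrime zetaZfPrime
  set A := {p : ℝ | ∃ M K τ : ℝ, 1 ≤ K ∧ K ≤ Kmax ρr ρd ρ0 T ∧ K ≤ τ ∧ τ < T ∧ K < M ∧
    p = Ptot M K τ R α ρr ρd ρs ρ0 T} with hA
  set B := fun R : ℝ ↦ {p : ℝ | ∃ M K : ℝ, 1 ≤ K ∧ K ≤ Kmax ρr ρd ρ0 T ∧ K < M ∧
    p = Pcsi M K R α ρr ρd ρs} with hB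
  have hBne (r : ℝ) : (B r).Nonempty := ⟨_, 2, 1, le_rfl, hKm, by norm_num, rfl⟩
  have hBlow (r : ℝ) (hr : 0 < r) : ∀ p ∈ B r, ρs ≤ p := by
    rintro p ⟨M, K, hK, -, hKM, rfl⟩
    exact le_Pcsi hα0 hρr hρd hK hKM hr
  have hBpos (r : ℝ) (hr : 0 < r) : 0 < sInf (B r) :=
    hρs.trans_le (le_csInf (hBne r) (hBlow r hr))
  have hquarter (K : ℝ) (hK : K ≤ Kmax ρr ρd ρ0 T) : K ≤ T / 4 := hK.trans (min_le_left _ _)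
  have hAne : A.Nonempty :=
    ⟨_, 2, 1, T / 4, le_rfl, hKm, hquarter 1 hKm, by linarith, by norm_num, rfl⟩
  have hAB : ∀ p ∈ A, sInf (B R) + 2 * ρ0 ≤ p := by
    rintro p ⟨M, K, τ, hK, hKx, hKτ, hτT, hKM, rfl⟩
    have h1 := csInf_le ⟨ρs, hBlow R hR⟩ (show Pcsi M K R α ρr ρd ρs ∈ B R from
      ⟨M, K, hK, hKx, hKM, rfl⟩)
    have h2 := Pcsi_add_le_Ptot (ρr := ρr) (ρd := ρd) (ρs := ρs) hα0 hρ0 hT0 hK hKτ hτT hKM hR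
    linarith
  have hAB' : sInf (B R) < sInf A := by linarith [le_csInf hAne hAB]
  have hApos : 0 < sInf A := (hBpos R hR).trans hAB'
  have hR' : 0 < 4 * R / 3 := by positivity
  have hAC : sInf A < 2 * sInf (B (4 * R / 3)) := by
    have : (sInf A + (ρs - α / 2)) / 2 ≤ sInf (B (4 * R / 3)) := by
      refine le_csInf (hBne _) ?_
      rintro p ⟨M, K, hK, hKx, hKM, rfl⟩
      have h1 := csInf_le ⟨_, hAB⟩ (show Ptot M K (T / 4) R α ρr ρd ρs ρ0 T ∈ A from
        ⟨M, K, T / 4, hK, hKx, hquarter K hKx, by linarith, hKM, rfl⟩)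
      have h2 := Ptot_quarter_le (ρs := ρs) hα0 hρ0 hT0 hK hKx hKM hR
      linarith
    linarith
  constructor
  · have e : 3 / 8 * (4 * R / 3 / sInf (B (4 * R / 3))) = R / (2 * sInf (B (4 * R / 3))) := by
      have := hBpos _ hR'
      field_simp
      norm_num
    change 3 / 8 * (4 * R / 3 / sInf (B (4 * R / 3))) < _
    rw [e]
    exact div_lt_div_of_pos_left hR hApos hAC
  · exact div_lt_div_of_pos_left hR (hBpos R hR) hAB'
end

section
/- Fix R > 0, α > 1, T > 1 and positive ratios β, δ, μ, and for ρ_r > 0 let Θ(ρ_r) := (α, ρ_r, β·ρ_r, δ·ρ_r, μ·ρ_r, T). If 0 < ρ_{r1} < ρ_{r2}, then ζ*_zf(R, Θ(ρ_{r1})) > ζ*_zf(R, Θ(ρ_{r2})); i.e., under proportional scaling of all power consumption parameters, the optimal normalized energy efficiency strictly increases as ρ_r decreases. -/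
open Real

theorem gammaU_nonneg {M K τ R T : ℝ} (hR : 0 ≤ R) (hK : 0 < K) (hτ : 0 < τ) (hτT : τ < T)
    (hM : K < M) : 0 ≤ gammaU M K τ R T := by
  have hT : 0 < T := hτ.trans hτT
  have h1 : 0 < 1 - τ / T := sub_pos.2 ((div_lt_one hT).2 hτT)
  have hE : 0 ≤ (2:ℝ) ^ (R / (K * (1 - τ / T))) - 1 :=
    sub_nonneg.2 (Real.one_le_rpow one_le_two (by positivity))
  have hMK : 0 < M - K := sub_pos.2 hM
  unfold gammaU
  positivity

/-- The consumption is at least the static part when the parameters are nonnegative. -/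
theorem le_Ptot {M K τ R α ρr ρd ρs ρ0 T : ℝ} (hR : 0 ≤ R) (hα : 0 ≤ α) (hK : 0 < K)
    (hτ : 0 < τ) (hτT : τ < T) (hM : K < M) (hr : 0 ≤ ρr) (hd : 0 ≤ ρd) (h0 : 0 ≤ ρ0) :
    ρs ≤ Ptot M K τ R α ρr ρd ρs ρ0 T := by
  have hγ := gammaU_nonneg hR hK hτ hτT hM
  have hT : 0 < T := hτ.trans hτT
  have hM0 : 0 < M := hK.trans hM
  have h1 : 0 ≤ α * K * gammaU M K τ R T := by positivity
  have h2 : 0 ≤ K * (ρd + (8/3) * K ^ 2 * ρ0 / T) := by positivity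
  have h3 : 0 ≤ M * (ρr + 2 * K * ρ0 + 4 * K ^ 2 * ρ0 / T) := by positivity
  unfold Ptot
  linarith

/-- Raising every parameter raises the consumption by at least the rise of the static part. -/
theorem Ptot_add_le {M K τ R α β δ μ ρ₁ ρ₂ T : ℝ} (hK : 0 < K) (hT : 0 < T) (hM : K < M)
    (hβ : 0 ≤ β) (hμ : 0 ≤ μ) (h12 : ρ₁ ≤ ρ₂) :
    Ptot M K τ R α ρ₁ (β * ρ₁) (δ * ρ₁) (μ * ρ₁) T + δ * (ρ₂ - ρ₁) ≤
      Ptot M K τ R α ρ₂ (β * ρ₂) (δ * ρ₂) (μ * ρ₂) T := by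
  have hM0 : 0 < M := hK.trans hM
  have hρ : 0 ≤ ρ₂ - ρ₁ := sub_nonneg.2 h12
  have h : 0 ≤ (ρ₂ - ρ₁) * (K * (β + (8/3) * K ^ 2 * μ / T) +
      M * (1 + 2 * K * μ + 4 * K ^ 2 * μ / T)) := by positivity
  unfold Ptot
  linear_combination h

/-- under proportional scaling of the PCPs, ζ*_zf strictly increases as
ρ_r decreases (Corollary 2). -/
theorem stmt_16 (R α T β δ μ ρr₁ ρr₂ : ℝ)
    (hR : 0 < R) (hα : 1 < α) (hT : 1 < T)
    (hβ : 0 < β) (hδ : 0 < δ) (hμ : 0 < μ)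
    (hρr₁ : 0 < ρr₁) (h12 : ρr₁ < ρr₂) :
    zetaZfStar R α ρr₂ (β * ρr₂) (δ * ρr₂) (μ * ρr₂) T <
      zetaZfStar R α ρr₁ (β * ρr₁) (δ * ρr₁) (μ * ρr₁) T := by
  set S : ℝ → Set ℝ := fun ρ ↦ {p : ℝ | ∃ M K τ : ℤ, 1 ≤ K ∧ K ≤ τ ∧ (τ : ℝ) < T ∧ K < M ∧
    p = Ptot (M : ℝ) (K : ℝ) (τ : ℝ) R α ρ (β * ρ) (δ * ρ) (μ * ρ) T} with hS
  have hne (ρ : ℝ) : (S ρ).Nonempty :=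
    ⟨_, 2, 1, 1, le_rfl, le_rfl, by exact_mod_cast hT, by norm_num, rfl⟩
  have hlow : ∀ p ∈ S ρr₁, δ * ρr₁ ≤ p := by
    rintro p ⟨M, K, τ, hK, hKτ, hτT, hKM, rfl⟩
    exact le_Ptot hR.le (by linarith) (by exact_mod_cast hK) (by exact_mod_cast hK.trans hKτ)
      hτT (by exact_mod_cast hKM) hρr₁.le (by positivity) (by positivity)
  have hpos : 0 < sInf (S ρr₁) := (mul_pos hδ hρr₁).trans_le (le_csInf (hne _) hlow)
  have hstep : sInf (S ρr₁) + δ * (ρr₂ - ρr₁) ≤ sInf (S ρr₂) := by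
    refine le_csInf (hne _) ?_
    rintro p ⟨M, K, τ, hK, hKτ, hτT, hKM, rfl⟩
    refine le_trans ?_ (Ptot_add_le (by exact_mod_cast hK) (by linarith)
      (by exact_mod_cast hKM) hβ.le hμ.le h12.le)
    gcongr
    exact csInf_le ⟨_, hlow⟩ ⟨M, K, τ, hK, hKτ, hτT, hKM, rfl⟩
  have hlt : sInf (S ρr₁) < sInf (S ρr₂) :=
    (lt_add_of_pos_right _ (mul_pos hδ (sub_pos.2 h12))).trans_le hstep
  exact div_lt_div_of_pos_left hR hpos hlt
end
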